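/- arXiv:2510.09965 — 2 statements merged into one kernel-verified Lean document; each statement's English description precedes it below -/
import Mathlib

section
/- (Performance equivalence under homomorphism.) Let P_S be a row-stochastic n×n real matrix with reward vector R_S ∈ ℝⁿ, P_U a row-stochastic m×m real matrix, P_ν an m×n real matrix, and γ ∈ (0,1), satisfying P_U · P_ν = P_ν · P_S and R_U = P_ν · R_S. Let ξ_S ∈ ℝⁿ and ξ_U ∈ ℝ^m satisfy ξ_Sᵀ = ξ_Uᵀ · P_ν. Then ξ_Uᵀ · V_U = ξ_Sᵀ · V_S, where V_S = (I − γP_S)⁻¹ R_S and V_U = (I − γP_U)⁻¹ R_U. -/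
open Matrix

/-- A real matrix is row-stochastic if all its entries are nonnegative and each row sums to 1. -/
def RowStochastic {n : Type*} [Fintype n] (P : Matrix n n ℝ) : Prop :=
  (∀ i j, 0 ≤ P i j) ∧ ∀ i, ∑ j, P i j = 1

/-- For a row-stochastic `P` and a discount factor `γ ∈ (0, 1)`, the matrix `1 - γ • P` is strictly
diagonally dominant, hence invertible. -/
theorem RowStochastic.isUnit_det_one_sub_smul {n : Type*} [Fintype n] [DecidableEq n]
    {P : Matrix n n ℝ} (hP : RowStochastic P) {γ : ℝ} (hγ : γ ∈ Set.Ioo (0 : ℝ) 1) :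
    IsUnit (1 - γ • P).det := by
  refine isUnit_iff_ne_zero.2 (det_ne_zero_of_sum_row_lt_diag fun k => ?_)
  have off : ∑ j ∈ Finset.univ.erase k, ‖(1 - γ • P) k j‖
      = γ * ∑ j ∈ Finset.univ.erase k, P k j := by
    rw [Finset.mul_sum]
    refine Finset.sum_congr rfl fun j hj => ?_
    simp [one_apply_ne (Finset.ne_of_mem_erase hj).symm, abs_of_pos hγ.1,
      abs_of_nonneg (hP.1 k j)]
  have split := Finset.add_sum_erase Finset.univ (P k) (Finset.mem_univ k)
  rw [hP.2 k] at split
  rw [off, eq_sub_of_add_eq' split]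
  refine lt_of_lt_of_le ?_ (Real.le_norm_self _)
  simp only [Matrix.sub_apply, one_apply_eq, Matrix.smul_apply, smul_eq_mul]
  linarith [hγ.2]

/-- Inverses preserve intertwining relations. -/
theorem Matrix.inv_mul_eq_mul_inv_of_mul_eq_mul {R m n : Type*} [CommRing R] [Fintype m] [Fintype n]
    [DecidableEq m] [DecidableEq n] {A : Matrix m m R} {B : Matrix n n R} {C : Matrix m n R}
    (hA : IsUnit A.det) (hB : IsUnit B.det) (h : A * C = C * B) : A⁻¹ * C = C * B⁻¹ := by
  rw [← mul_nonsing_inv_cancel_right B (A⁻¹ * C) hB, Matrix.mul_assoc A⁻¹ C B, ← h,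
    nonsing_inv_mul_cancel_left A C hA]

/-- **Performance equivalence under homomorphism.**
If `P_U ⬝ P_ν = P_ν ⬝ P_S`, `R_U = P_ν ⬝ R_S` and `ξ_Sᵀ = ξ_Uᵀ ⬝ P_ν`, then
`ξ_Uᵀ V_U = ξ_Sᵀ V_S` where `V_S = (I - γP_S)⁻¹ R_S` and `V_U = (I - γP_U)⁻¹ R_U`. -/
theorem performance_equivalence {m n : Type*} [Fintype m] [Fintype n]
    [DecidableEq m] [DecidableEq n]
    (P_S : Matrix n n ℝ) (hS : RowStochastic P_S) (R_S : n → ℝ)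
    (P_U : Matrix m m ℝ) (hU : RowStochastic P_U) (R_U : m → ℝ)
    (P_ν : Matrix m n ℝ) (γ : ℝ) (hγ : γ ∈ Set.Ioo (0 : ℝ) 1)
    (hP : P_U * P_ν = P_ν * P_S) (hR : R_U = P_ν *ᵥ R_S)
    (ξ_S : n → ℝ) (ξ_U : m → ℝ) (hξ : ξ_S = ξ_U ᵥ* P_ν)
    (V_S : n → ℝ) (hVS : V_S = (1 - γ • P_S)⁻¹ *ᵥ R_S)
    (V_U : m → ℝ) (hVU : V_U = (1 - γ • P_U)⁻¹ *ᵥ R_U) :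
    ξ_U ⬝ᵥ V_U = ξ_S ⬝ᵥ V_S := by
  have hinter : (1 - γ • P_U) * P_ν = P_ν * (1 - γ • P_S) := by
    simp [Matrix.sub_mul, Matrix.mul_sub, hP]
  rw [hVU, hVS, hR, hξ, mulVec_mulVec, inv_mul_eq_mul_inv_of_mul_eq_mul
    (hU.isUnit_det_one_sub_smul hγ) (hS.isUnit_det_one_sub_smul hγ) hinter,
    ← mulVec_mulVec, dotProduct_mulVec]
end

section
/- (Policy-performance lower bound.) Let ξ ∈ ℝⁿ be a probability vector, P a row-stochastic n×n real matrix, γ ∈ (0,1), M an n×n real matrix such that I − γM is invertible, and R ∈ ℝⁿ. Set V = (I − γP)⁻¹R and V̂ = (I − γM)⁻¹R. Then the true performance is bounded below by the approximate performance minus the discounted approximation error: ξᵀV ≥ ξᵀV̂ − (γ/(1 − γ)) · max_s |((P − M)V̂)(s)|. -/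
open Matrix

/-- A real vector is a probability vector if its entries are nonnegative and sum to 1. -/
def ProbVector {m : Type*} [Fintype m] (ξ : m → ℝ) : Prop :=
  (∀ u, 0 ≤ ξ u) ∧ ∑ u, ξ u = 1

/-- A vector dominating a `γ`-discounted stochastic average of itself up to an additive loss `c`
is bounded below by `-c / (1 - γ)`. -/
theorem RowStochastic.neg_div_le_of_discounted_le {n : Type*} [Fintype n]
    {P : Matrix n n ℝ} (hP : RowStochastic P) {γ : ℝ} (hγ : γ ∈ Set.Ico (0 : ℝ) 1)
    {D : n → ℝ} {c : ℝ} (h : ∀ s, γ * (P *ᵥ D) s - c ≤ D s) (s : n) :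
    -(c / (1 - γ)) ≤ D s := by
  have : Nonempty n := ⟨s⟩
  obtain ⟨t, ht⟩ := Finite.exists_min D
  have hmean : D t ≤ (P *ᵥ D) t := by
    calc D t = ∑ j, P t j * D t := by rw [← Finset.sum_mul, hP.2 t, one_mul]
      _ ≤ ∑ j, P t j * D j :=
        Finset.sum_le_sum fun j _ => mul_le_mul_of_nonneg_left (ht j) (hP.1 t j)
  have hpos : 0 < 1 - γ := sub_pos.2 hγ.2
  refine le_trans ?_ (ht s)
  rw [← neg_div, div_le_iff₀ hpos]
  linarith [h t, mul_le_mul_of_nonneg_left hmean hγ.1]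

/-- The matrix `1 - γ • P` is invertible for `P` row-stochastic and `γ ∈ [0, 1)`. -/
theorem RowStochastic.isUnit_one_sub_smul {n : Type*} [Fintype n] [DecidableEq n]
    {P : Matrix n n ℝ} (hP : RowStochastic P) {γ : ℝ} (hγ : γ ∈ Set.Ico (0 : ℝ) 1) :
    IsUnit (1 - γ • P) := by
  have key : ∀ v : n → ℝ, (1 - γ • P) *ᵥ v = 0 → ∀ s, 0 ≤ v s := by
    intro v hv s
    have h := hP.neg_div_le_of_discounted_le (D := v) (c := 0) hγ (fun t => by
      have := congrFun hv t
      simp only [sub_mulVec, one_mulVec, smul_mulVec, Pi.sub_apply, Pi.smul_apply, smul_eq_mul,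
        Pi.zero_apply] at this
      linarith) s
    simpa using h
  rw [← mulVec_injective_iff_isUnit]
  refine (injective_iff_map_eq_zero (mulVecLin (1 - γ • P))).2 fun v hv => ?_
  rw [mulVecLin_apply] at hv
  ext s
  have hneg := key (-v) (by rw [mulVec_neg, hv, neg_zero]) s
  rw [Pi.neg_apply] at hneg
  exact le_antisymm (neg_nonneg.1 hneg) (key v hv s)

/-- **Policy-performance lower bound.**
With `V = (I - γP)⁻¹R` and `V̂ = (I - γM)⁻¹R`,
`ξᵀV ≥ ξᵀV̂ - (γ/(1 - γ)) · max_s |((P - M)V̂)(s)|`. -/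
theorem policy_performance_lower_bound {n : Type*} [Fintype n] [DecidableEq n]
    (ξ : n → ℝ) (hξ : ProbVector ξ)
    (P : Matrix n n ℝ) (hP : RowStochastic P)
    (γ : ℝ) (hγ : γ ∈ Set.Ioo (0 : ℝ) 1)
    (M : Matrix n n ℝ) (hM : IsUnit (1 - γ • M)) (R : n → ℝ)
    (V : n → ℝ) (hV : V = (1 - γ • P)⁻¹ *ᵥ R)
    (Vhat : n → ℝ) (hVhat : Vhat = (1 - γ • M)⁻¹ *ᵥ R) :
    ξ ⬝ᵥ V ≥ ξ ⬝ᵥ Vhat - γ / (1 - γ) * ⨆ s, |((P - M) *ᵥ Vhat) s| := by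
  have hγ' : γ ∈ Set.Ico (0 : ℝ) 1 := ⟨hγ.1.le, hγ.2⟩
  have hRV : (1 - γ • P) *ᵥ V = R := by
    rw [hV, mulVec_mulVec, mul_nonsing_inv _
      ((isUnit_iff_isUnit_det _).1 (hP.isUnit_one_sub_smul hγ')), one_mulVec]
  have hRVhat : (1 - γ • M) *ᵥ Vhat = R := by
    rw [hVhat, mulVec_mulVec, mul_nonsing_inv _ ((isUnit_iff_isUnit_det _).1 hM), one_mulVec]
  set E := ⨆ s, |((P - M) *ᵥ Vhat) s|
  have hbound : ∀ s, -(γ * E / (1 - γ)) ≤ (V - Vhat) s := by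
    refine hP.neg_div_le_of_discounted_le hγ' fun s => ?_
    have hle : |((P - M) *ᵥ Vhat) s| ≤ E :=
      le_ciSup (f := fun s => |((P - M) *ᵥ Vhat) s|) (Set.finite_range _).bddAbove s
    have herr := mul_le_mul_of_nonneg_left ((neg_le_abs _).trans hle) hγ'.1
    have hs := congrFun (hRV.trans hRVhat.symm) s
    simp only [sub_mulVec, one_mulVec, smul_mulVec, mulVec_sub, Pi.sub_apply, Pi.smul_apply,
      smul_eq_mul] at hs herr ⊢
    linarith
  have hmean : -(γ * E / (1 - γ)) ≤ ξ ⬝ᵥ (V - Vhat) := by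
    calc -(γ * E / (1 - γ)) = ∑ s, ξ s * -(γ * E / (1 - γ)) := by
          rw [← Finset.sum_mul, hξ.2, one_mul]
      _ ≤ ∑ s, ξ s * (V - Vhat) s :=
        Finset.sum_le_sum fun s _ => mul_le_mul_of_nonneg_left (hbound s) (hξ.1 s)
  rw [dotProduct_sub, mul_div_right_comm] at hmean
  linarith
end
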